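/- For ρ > 1, define R(ρ) = (1/2 + Σ_{k≥1} ρ^{−(2k)²}) / (Σ_{k≥0} ρ^{−(2k+1)²}). Then R(ρ) − 1 ~ 4·exp(−π²/(4 log ρ)) as ρ → 1⁺. -/

import Mathlib

open Real Filter

/-- Szegő's analyticity radius for the inverted ρ-ellipse. -/
noncomputable def analyticityRadius (ρ : ℝ) : ℝ :=
  (1 / 2 + ∑' k : ℕ, ρ ^ (-((2 * ((k : ℝ) + 1)) ^ 2))) /
    (∑' k : ℕ, ρ ^ (-((2 * (k : ℝ) + 1) ^ 2)))

lemma summable_exp_neg_mul_nat_sq {t : ℝ} (ht : 0 < t) :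
    Summable fun k : ℕ => exp (-t * (k : ℝ) ^ 2) := by
  have hgeo : Summable fun k : ℕ => exp (-t) ^ k :=
    summable_geometric_of_lt_one (exp_pos _).le (by simpa using ht)
  refine Summable.of_nonneg_of_le (fun k => (exp_pos _).le) (fun k => ?_) hgeo
  rw [← exp_nat_mul, exp_le_exp]
  have h : (k : ℝ) ≤ (k : ℝ) ^ 2 := by exact_mod_cast Nat.le_self_pow two_ne_zero k
  nlinarith

lemma tsum_int_exp_neg_mul_sq {t : ℝ} (ht : 0 < t) :
    ∑' n : ℤ, exp (-t * (n : ℝ) ^ 2) = 1 + 2 * ∑' k : ℕ, exp (-t * ((k : ℝ) + 1) ^ 2) := by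
  have hs := summable_exp_neg_mul_nat_sq ht
  have hs1 : Summable fun k : ℕ => exp (-t * ((k : ℝ) + 1) ^ 2) := by
    simpa using (summable_nat_add_iff 1).2 hs
  have hneg : (fun k : ℕ => exp (-t * (((-((k : ℤ) + 1) : ℤ)) : ℝ) ^ 2)) =
      fun k : ℕ => exp (-t * ((k : ℝ) + 1) ^ 2) := by
    funext k
    push_cast
    rw [neg_sq]
  have h := (HasSum.of_nat_of_neg_add_one (f := fun n : ℤ => exp (-t * (n : ℝ) ^ 2))
    hs.hasSum (by rw [hneg]; exact hs1.hasSum)).tsum_eq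
  rw [h, hs.tsum_eq_zero_add]
  push_cast
  rw [zero_pow two_ne_zero, mul_zero, exp_zero]
  ring

lemma tsum_nat_even_add_odd_exp_neg_mul_sq {t : ℝ} (ht : 0 < t) :
    ∑' n : ℤ, exp (-t * (n : ℝ) ^ 2) =
      ∑' n : ℤ, exp (-(4 * t) * (n : ℝ) ^ 2) +
        2 * ∑' k : ℕ, exp (-t * (2 * (k : ℝ) + 1) ^ 2) := by
  have hs := summable_exp_neg_mul_nat_sq ht
  have he : Summable fun k : ℕ => exp (-t * ((2 * k : ℕ) : ℝ) ^ 2) :=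
    hs.comp_injective (i := fun k : ℕ => 2 * k) (fun a b h => by simpa using h)
  have ho : Summable fun k : ℕ => exp (-t * ((2 * k + 1 : ℕ) : ℝ) ^ 2) :=
    hs.comp_injective (i := fun k : ℕ => 2 * k + 1) (fun a b h => by simpa using h)
  have h := tsum_even_add_odd (f := fun k : ℕ => exp (-t * (k : ℝ) ^ 2)) he ho
  have he' : ∀ k : ℕ, exp (-t * ((2 * k : ℕ) : ℝ) ^ 2) = exp (-(4 * t) * (k : ℝ) ^ 2) := by
    intro k
    push_cast
    ring_nf
  simp_rw [he'] at h
  rw [tsum_int_exp_neg_mul_sq ht, tsum_int_exp_neg_mul_sq (by positivity : 0 < 4 * t)]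
  rw [hs.tsum_eq_zero_add,
    (summable_exp_neg_mul_nat_sq (by positivity : 0 < 4 * t)).tsum_eq_zero_add] at h
  push_cast at h
  simp only [ne_eq, OfNat.ofNat_ne_zero, not_false_eq_true, zero_pow, mul_zero, exp_zero] at h
  linarith

lemma analyticityRadius_eq_tsum_int {ρ : ℝ} (hρ : 1 < ρ) :
    analyticityRadius ρ = (∑' n : ℤ, exp (-(4 * log ρ) * (n : ℝ) ^ 2)) /
      (∑' n : ℤ, exp (-log ρ * (n : ℝ) ^ 2) - ∑' n : ℤ, exp (-(4 * log ρ) * (n : ℝ) ^ 2)) := by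
  have ht : 0 < log ρ := log_pos hρ
  rw [tsum_nat_even_add_odd_exp_neg_mul_sq ht, add_sub_cancel_left,
    tsum_int_exp_neg_mul_sq (by positivity : 0 < 4 * log ρ), analyticityRadius]
  have h1 : ∀ k : ℕ, ρ ^ (-((2 * ((k : ℝ) + 1)) ^ 2)) =
      exp (-(4 * log ρ) * ((k : ℝ) + 1) ^ 2) := fun k => by
    rw [rpow_def_of_pos (by linarith)]; ring_nf
  have h2 : ∀ k : ℕ, ρ ^ (-((2 * (k : ℝ) + 1) ^ 2)) =
      exp (-log ρ * (2 * (k : ℝ) + 1) ^ 2) := fun k => by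
    rw [rpow_def_of_pos (by linarith)]; ring_nf
  simp_rw [h1, h2]
  rw [← mul_div_mul_left _ _ (two_ne_zero' ℝ)]
  ring_nf

lemma tsum_int_exp_neg_mul_sq_inversion {t : ℝ} (ht : 0 < t) :
    ∑' n : ℤ, exp (-t * (n : ℝ) ^ 2) =
      √(π / t) * ∑' n : ℤ, exp (-(π ^ 2 / t) * (n : ℝ) ^ 2) := by
  have h := Real.tsum_exp_neg_mul_int_sq (a := t / π) (by positivity)
  have h1 : -π * (t / π) = -t := by field_simp
  have h2 : -π / (t / π) = -(π ^ 2 / t) := by field_simp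
  rw [h1, h2, ← sqrt_eq_rpow, one_div, ← sqrt_inv, inv_div] at h
  exact h

lemma analyticityRadius_sub_one {ρ u : ℝ} (hρ : 1 < ρ) (hu : u = π ^ 2 / (4 * log ρ))
    (hd : 1 + 4 * ∑' k : ℕ, exp (-(4 * u) * ((k : ℝ) + 1) ^ 2) -
      2 * ∑' k : ℕ, exp (-u * ((k : ℝ) + 1) ^ 2) ≠ 0) :
    analyticityRadius ρ - 1 =
      4 * (∑' k : ℕ, exp (-u * ((k : ℝ) + 1) ^ 2) -
        ∑' k : ℕ, exp (-(4 * u) * ((k : ℝ) + 1) ^ 2)) /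
      (1 + 4 * ∑' k : ℕ, exp (-(4 * u) * ((k : ℝ) + 1) ^ 2) -
        2 * ∑' k : ℕ, exp (-u * ((k : ℝ) + 1) ^ 2)) := by
  have ht : 0 < log ρ := log_pos hρ
  have hu0 : 0 < u := by rw [hu]; positivity
  have h4 : π ^ 2 / log ρ = 4 * u := by rw [hu]; field_simp
  have hsqrt : √(π / log ρ) = 2 * √(π / (4 * log ρ)) := by
    rw [show π / log ρ = 2 ^ 2 * (π / (4 * log ρ)) by field_simp; norm_num,
      sqrt_mul (by norm_num), sqrt_sq (by norm_num)]
  have hc : √(π / (4 * log ρ)) ≠ 0 := by positivity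
  rw [analyticityRadius_eq_tsum_int hρ, tsum_int_exp_neg_mul_sq_inversion ht,
    tsum_int_exp_neg_mul_sq_inversion (by positivity : 0 < 4 * log ρ), ← hu, h4, hsqrt,
    tsum_int_exp_neg_mul_sq hu0, tsum_int_exp_neg_mul_sq (by positivity : 0 < 4 * u)]
  generalize (∑' k : ℕ, exp (-u * ((k : ℝ) + 1) ^ 2)) = a at *
  generalize (∑' k : ℕ, exp (-(4 * u) * ((k : ℝ) + 1) ^ 2)) = b at *
  generalize √(π / (4 * log ρ)) = c at *
  rw [show 2 * c * (1 + 2 * b) - c * (1 + 2 * a) = c * (1 + 4 * b - 2 * a) by ring,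
    mul_div_mul_left _ _ hc, div_sub_one hd]
  ring

lemma tendsto_tsum_exp_neg_mul_sq_div_exp_neg :
    Tendsto (fun u : ℝ => (∑' k : ℕ, exp (-u * ((k : ℝ) + 1) ^ 2)) / exp (-u)) atTop (nhds 1) := by
  have hexp : Tendsto (fun u : ℝ => exp (-u)) atTop (nhds 0) := tendsto_exp_neg_atTop_nhds_zero
  have hub : Tendsto (fun u : ℝ => (1 - exp (-u))⁻¹) atTop (nhds 1) := by
    simpa using (hexp.const_sub 1).inv₀ (by norm_num)
  refine tendsto_of_tendsto_of_tendsto_of_le_of_le' tendsto_const_nhds hub ?_ ?_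
  all_goals
    filter_upwards [eventually_gt_atTop 0] with u hu
    have hs : Summable fun k : ℕ => exp (-u * ((k : ℝ) + 1) ^ 2) := by
      simpa using (summable_nat_add_iff 1).2 (summable_exp_neg_mul_nat_sq hu)
  · rw [one_le_div (exp_pos _)]
    simpa using hs.le_tsum 0 (fun k _ => (exp_pos _).le)
  · have hq : exp (-u) < 1 := by simpa using hu
    rw [div_le_iff₀ (exp_pos _), ← tsum_geometric_of_lt_one (exp_pos _).le hq, ← tsum_mul_right]
    refine hs.tsum_le_tsum (fun k => ?_)
      ((summable_geometric_of_lt_one (exp_pos _).le hq).mul_right _)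
    rw [← pow_succ, ← exp_nat_mul, exp_le_exp]
    push_cast
    have hk : (0 : ℝ) ≤ k := k.cast_nonneg
    nlinarith [mul_nonneg hu.le (mul_nonneg hk (by linarith : (0 : ℝ) ≤ k + 1))]

/-- **Theorem 5 of the paper (first asymptotic).**
`R(ρ) − 1 ~ 4 e^{−π²/(4 log ρ)}` as `ρ → 1⁺`. -/
theorem analyticity_radius_asymptotics :
    Tendsto
      (fun ρ : ℝ => (analyticityRadius ρ - 1) / (4 * Real.exp (-(π ^ 2) / (4 * Real.log ρ))))
      (nhdsWithin 1 (Set.Ioi 1)) (nhds 1) := by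
  set g : ℝ → ℝ := fun u => ∑' k : ℕ, exp (-u * ((k : ℝ) + 1) ^ 2) with hg
  have hexp : Tendsto (fun u : ℝ => exp (-u)) atTop (nhds 0) := tendsto_exp_neg_atTop_nhds_zero
  have h1 : Tendsto (fun u => g u / exp (-u)) atTop (nhds 1) :=
    tendsto_tsum_exp_neg_mul_sq_div_exp_neg
  have hg0 : Tendsto g atTop (nhds 0) := by
    have h := h1.mul hexp
    rw [mul_zero] at h
    exact h.congr fun u => div_mul_cancel₀ _ (exp_pos _).ne'
  have hmul : Tendsto (fun u : ℝ => 4 * u) atTop atTop :=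
    tendsto_id.const_mul_atTop (by norm_num)
  have h4 : Tendsto (fun u => g (4 * u) / exp (-u)) atTop (nhds 0) := by
    have h := (h1.comp hmul).mul (hexp.pow 3)
    rw [zero_pow three_ne_zero, mul_zero] at h
    refine h.congr fun u => ?_
    have he : exp (-(4 * u)) = exp (-u) ^ 3 * exp (-u) := by
      rw [← pow_succ, ← exp_nat_mul]; congr 1; push_cast; ring
    simp only [Function.comp_apply, he]
    field_simp
  have hd : Tendsto (fun u => 1 + 4 * g (4 * u) - 2 * g u) atTop (nhds 1) := by
    simpa using (((hg0.comp hmul).const_mul 4).const_add 1).sub (hg0.const_mul 2)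
  have hmain : Tendsto (fun u => (g u / exp (-u) - g (4 * u) / exp (-u)) /
      (1 + 4 * g (4 * u) - 2 * g u)) atTop (nhds 1) := by
    have h := (h1.sub h4).div hd one_ne_zero
    rwa [sub_zero, div_one] at h
  have hlog : Tendsto (fun ρ : ℝ => 4 * log ρ) (nhdsWithin 1 (Set.Ioi 1))
      (nhdsWithin 0 (Set.Ioi 0)) := by
    refine tendsto_nhdsWithin_iff.2 ⟨?_, ?_⟩
    · have h := ((continuousAt_log one_ne_zero).tendsto.const_mul 4).mono_left
        (nhdsWithin_le_nhds (s := Set.Ioi 1))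
      simpa using h
    · filter_upwards [self_mem_nhdsWithin] with ρ hρ
      exact mul_pos (by norm_num) (log_pos hρ)
  have hu : Tendsto (fun ρ : ℝ => π ^ 2 / (4 * log ρ)) (nhdsWithin 1 (Set.Ioi 1)) atTop := by
    simpa [div_eq_mul_inv] using
      (tendsto_inv_nhdsGT_zero.comp hlog).const_mul_atTop (by positivity : 0 < π ^ 2)
  refine (hmain.comp hu).congr' ?_
  filter_upwards [self_mem_nhdsWithin, hu.eventually (hd.eventually_ne one_ne_zero)] with ρ hρ hne
  rw [analyticityRadius_sub_one hρ rfl hne, neg_div]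
  simp only [Function.comp_apply, hg]
  field_simp
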